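/- Let 1 ≤ r < ∞ and m ≥ 1. If a kernel K(x, y_1, …, y_m) satisfies assumption (H2) with constant C and exponent δ > n/r, then K satisfies the m-linear L^r-Hörmander condition; quantitatively, K_r ≤ c C Σ_{j=1}^∞ 2^{-mδj}(1+j)·2^{mnj/r}·(side-length factors cancelling to give) K_r ≲ C Σ_{j=1}^∞ 2^{-m(δ−n/r)j}(1+j) < ∞, with the implicit constant depending only on n, m, δ, r. -/

import Mathlib

open MeasureTheory ENNReal Set Real Filter

noncomputable section

/-- An axis-parallel (half-open) cube in ℝⁿ, given by its center and side length. -/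
structure Cube (n : ℕ) where
  center : Fin n → ℝ
  side : ℝ

namespace Cube

/-- The half-open cube as a subset of ℝⁿ. -/
def set {n : ℕ} (Q : Cube n) : Set (Fin n → ℝ) :=
  {x | ∀ i, Q.center i - Q.side / 2 ≤ x i ∧ x i < Q.center i + Q.side / 2}

/-- The concentric dilate `tQ` of a cube `Q`. -/
def dilate {n : ℕ} (Q : Cube n) (t : ℝ) : Cube n := ⟨Q.center, t * Q.side⟩

end Cube

/-- The `L^p`-norm `(∫ |f|^p)^{1/p}` (with real exponent `p`), valued in `ℝ≥0∞`. -/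
def lpnorm {α : Type*} [MeasureSpace α] (f : α → ℝ) (p : ℝ) : ℝ≥0∞ :=
  (∫⁻ x, ENNReal.ofReal (|f x| ^ p)) ^ (1 / p)

/-- The weak `L^p` quasinorm `sup_{t>0} t |{|g| > t}|^{1/p}`. -/
def wnorm {α : Type*} [MeasureSpace α] (g : α → ℝ) (p : ℝ) : ℝ≥0∞ :=
  ⨆ t : Set.Ioi (0 : ℝ), ENNReal.ofReal t.1 * volume {x | t.1 < |g x|} ^ (1 / p)

/-- The weak `L^p` quasinorm for an `ℝ≥0∞`-valued function. -/
def wnormE {α : Type*} [MeasureSpace α] (g : α → ℝ≥0∞) (p : ℝ) : ℝ≥0∞ :=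
  ⨆ t : Set.Ioi (0 : ℝ), ENNReal.ofReal t.1 * volume {x | ENNReal.ofReal t.1 < g x} ^ (1 / p)

/-- `(⨍_Q |f|^r)^{1/r}`. -/
def avgR {n : ℕ} (Q : Cube n) (f : (Fin n → ℝ) → ℝ) (r : ℝ) : ℝ≥0∞ :=
  ((volume Q.set)⁻¹ * ∫⁻ y in Q.set, ENNReal.ofReal (|f y| ^ r)) ^ (1 / r)

/-- A sparse family of cubes: for some `0 < γ < 1`, each `Q ∈ S` contains a
measurable portion `E Q ⊆ Q` with `|E Q| ≥ γ|Q|`, the `E Q` pairwise disjoint. -/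
def IsSparse {n : ℕ} (S : Set (Cube n)) : Prop :=
  S.Countable ∧ ∃ γ : ℝ, 0 < γ ∧ γ < 1 ∧ ∃ E : Cube n → Set (Fin n → ℝ),
    (∀ Q ∈ S, E Q ⊆ Q.set ∧ ENNReal.ofReal γ * volume Q.set ≤ volume (E Q)) ∧
    (∀ Q ∈ S, ∀ Q' ∈ S, Q ≠ Q' → Disjoint (E Q) (E Q'))

/-- `Q` is a dyadic subcube of `Q₀` (obtained by `k` successive bisections of the sides). -/
def IsDyadicSub {n : ℕ} (Q0 Q : Cube n) : Prop :=
  ∃ k : ℕ, ∃ j : Fin n → ℕ, (∀ i, j i < 2 ^ k) ∧ Q.side = Q0.side / 2 ^ k ∧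
    ∀ i, Q.center i = Q0.center i - Q0.side / 2 + ((j i : ℝ) + 1 / 2) * (Q0.side / 2 ^ k)

/-- The grand maximal truncated operator of an `m`-(sub)linear operator `T`. -/
def MTm {n m : ℕ} (T : (Fin m → ((Fin n → ℝ) → ℝ)) → (Fin n → ℝ) → ℝ)
    (f : Fin m → (Fin n → ℝ) → ℝ) (x : Fin n → ℝ) : ℝ≥0∞ :=
  ⨆ Q : {Q : Cube n // x ∈ Q.set},
    essSup (fun ξ => ENNReal.ofReal
      |T f ξ - T (fun i => (Q.1.dilate 3).set.indicator (f i)) ξ|)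
      (volume.restrict Q.1.set)

/-- The grand maximal truncated operator of a bilinear operator `T`. -/
def MT2 {n : ℕ} (T : ((Fin n → ℝ) → ℝ) → ((Fin n → ℝ) → ℝ) → (Fin n → ℝ) → ℝ)
    (f1 f2 : (Fin n → ℝ) → ℝ) (x : Fin n → ℝ) : ℝ≥0∞ :=
  ⨆ Q : {Q : Cube n // x ∈ Q.set},
    essSup (fun ξ => ENNReal.ofReal
      |T f1 f2 ξ - T ((Q.1.dilate 3).set.indicator f1) ((Q.1.dilate 3).set.indicator f2) ξ|)
      (volume.restrict Q.1.set)

/-- The local grand maximal truncated operator of a bilinear `T` relative to a cube `Q₀`. -/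
def MTloc {n : ℕ} (T : ((Fin n → ℝ) → ℝ) → ((Fin n → ℝ) → ℝ) → (Fin n → ℝ) → ℝ)
    (Q0 : Cube n) (f1 f2 : (Fin n → ℝ) → ℝ) (x : Fin n → ℝ) : ℝ≥0∞ :=
  ⨆ Q : {Q : Cube n // x ∈ Q.set ∧ Q.set ⊆ Q0.set},
    essSup (fun ξ => ENNReal.ofReal
      |T ((Q0.dilate 3).set.indicator f1) ((Q0.dilate 3).set.indicator f2) ξ -
        T ((Q.1.dilate 3).set.indicator f1) ((Q.1.dilate 3).set.indicator f2) ξ|)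
      (volume.restrict Q.1.set)

/-- The bilinear Hardy–Littlewood maximal function `𝓜(f,g)(x) = sup_{Q∋x} ⨍_Q|f| ⨍_Q|g|`. -/
def Mbil {n : ℕ} (f g : (Fin n → ℝ) → ℝ) (x : Fin n → ℝ) : ℝ≥0∞ :=
  ⨆ Q : {Q : Cube n // x ∈ Q.set},
    (((volume Q.1.set)⁻¹) * ∫⁻ y in Q.1.set, ENNReal.ofReal |f y|) *
      (((volume Q.1.set)⁻¹) * ∫⁻ y in Q.1.set, ENNReal.ofReal |g y|)

/-- `M_s h(x) = sup_{Q∋x} (⨍_Q |h|^s)^{1/s}`. -/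
def Msharp {n : ℕ} (s : ℝ) (h : (Fin n → ℝ) → ℝ) (x : Fin n → ℝ) : ℝ≥0∞ :=
  ⨆ Q : {Q : Cube n // x ∈ Q.set},
    (((volume Q.1.set)⁻¹) * ∫⁻ y in Q.1.set, ENNReal.ofReal (|h y| ^ s)) ^ (1 / s)

/-- `(∫_S |K(x,·)-K(z,·)|^{r'})^{1/r'}` for an `m`-linear kernel, with the usual
`essential supremum` interpretation when `r = 1` (`r' = ∞`). -/
def kdiffM {n : ℕ} (m : ℕ) (r : ℝ) (K : (Fin n → ℝ) → (Fin m → Fin n → ℝ) → ℝ)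
    (x z : Fin n → ℝ) (S : Set (Fin m → Fin n → ℝ)) : ℝ≥0∞ :=
  if r = 1 then essSup (fun y => ENNReal.ofReal |K x y - K z y|) (volume.restrict S)
  else (∫⁻ y in S, ENNReal.ofReal (|K x y - K z y| ^ (r / (r - 1)))) ^ ((r - 1) / r)

/-- The annular region `(2^{k+1}Q)^m \ (2^k Q)^m`. -/
def mring {n : ℕ} (m : ℕ) (Q : Cube n) (k : ℕ) : Set (Fin m → Fin n → ℝ) :=
  {y | ∀ i, y i ∈ (Q.dilate ((2 : ℝ) ^ (k + 1))).set} \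
    {y | ∀ i, y i ∈ (Q.dilate ((2 : ℝ) ^ k)).set}

/-- The `m`-linear `L^r`-Hörmander constant `K_r` of a kernel `K`. -/
def KhormM {n : ℕ} (m : ℕ) (r : ℝ) (K : (Fin n → ℝ) → (Fin m → Fin n → ℝ) → ℝ) : ℝ≥0∞ :=
  ⨆ Q : Cube n, ⨆ x : (Q.dilate (1 / 2)).set, ⨆ z : (Q.dilate (1 / 2)).set,
    ∑' k : ℕ, volume ((Q.dilate ((2 : ℝ) ^ (k + 1))).set) ^ ((m : ℝ) / r) *
      kdiffM m r K x.1 z.1 (mring m Q k)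

/-- Bilinear version of `kdiffM` (real-valued kernel). -/
def kdiff2 {n : ℕ} (r : ℝ) (K : (Fin n → ℝ) → (Fin n → ℝ) → (Fin n → ℝ) → ℝ)
    (x z : Fin n → ℝ) (S : Set ((Fin n → ℝ) × (Fin n → ℝ))) : ℝ≥0∞ :=
  if r = 1 then essSup (fun y => ENNReal.ofReal |K x y.1 y.2 - K z y.1 y.2|) (volume.restrict S)
  else (∫⁻ y in S, ENNReal.ofReal (|K x y.1 y.2 - K z y.1 y.2| ^ (r / (r - 1)))) ^ ((r - 1) / r)

/-- The annular region `(2^{k+1}Q)² \ (2^k Q)²`. -/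
def ring2 {n : ℕ} (Q : Cube n) (k : ℕ) : Set ((Fin n → ℝ) × (Fin n → ℝ)) :=
  ((Q.dilate ((2 : ℝ) ^ (k + 1))).set ×ˢ (Q.dilate ((2 : ℝ) ^ (k + 1))).set) \
    ((Q.dilate ((2 : ℝ) ^ k)).set ×ˢ (Q.dilate ((2 : ℝ) ^ k)).set)

/-- The bilinear `L^r`-Hörmander constant `K_r` of a (real-valued) kernel `K`. -/
def Khorm2 {n : ℕ} (r : ℝ) (K : (Fin n → ℝ) → (Fin n → ℝ) → (Fin n → ℝ) → ℝ) : ℝ≥0∞ :=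
  ⨆ Q : Cube n, ⨆ x : (Q.dilate (1 / 2)).set, ⨆ z : (Q.dilate (1 / 2)).set,
    ∑' k : ℕ, volume ((Q.dilate ((2 : ℝ) ^ (k + 1))).set) ^ ((2 : ℝ) / r) *
      kdiff2 r K x.1 z.1 (ring2 Q k)

/-- Bilinear `kdiff` for a complex-valued kernel. -/
def kdiff2C {n : ℕ} (r : ℝ) (K : (Fin n → ℝ) → (Fin n → ℝ) → (Fin n → ℝ) → ℂ)
    (x z : Fin n → ℝ) (S : Set ((Fin n → ℝ) × (Fin n → ℝ))) : ℝ≥0∞ :=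
  if r = 1 then essSup (fun y => ENNReal.ofReal ‖K x y.1 y.2 - K z y.1 y.2‖) (volume.restrict S)
  else (∫⁻ y in S, ENNReal.ofReal (‖K x y.1 y.2 - K z y.1 y.2‖ ^ (r / (r - 1)))) ^ ((r - 1) / r)

/-- The bilinear `L^r`-Hörmander constant of a complex-valued kernel `K`. -/
def Khorm2C {n : ℕ} (r : ℝ) (K : (Fin n → ℝ) → (Fin n → ℝ) → (Fin n → ℝ) → ℂ) : ℝ≥0∞ :=
  ⨆ Q : Cube n, ⨆ x : (Q.dilate (1 / 2)).set, ⨆ z : (Q.dilate (1 / 2)).set,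
    ∑' k : ℕ, volume ((Q.dilate ((2 : ℝ) ^ (k + 1))).set) ^ ((2 : ℝ) / r) *
      kdiff2C r K x.1 z.1 (ring2 Q k)

/-- The dyadic annulus `S_j(Q)`: `S_0(Q) = Q` and `S_j(Q) = 2^jQ \ 2^{j-1}Q` for `j ≥ 1`. -/
def Sring {n : ℕ} (Q : Cube n) (j : ℕ) : Set (Fin n → ℝ) :=
  if j = 0 then Q.set else (Q.dilate ((2 : ℝ) ^ j)).set \ (Q.dilate ((2 : ℝ) ^ (j - 1))).set

namespace Cube

variable {n : ℕ}

lemma set_eq_pi_Ico (Q : Cube n) :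
    Q.set = univ.pi fun i => Ico (Q.center i - Q.side / 2) (Q.center i + Q.side / 2) := by
  ext x
  simp [Cube.set, Set.mem_pi]

lemma volume_set_rpow (Q : Cube n) (hs : 0 < Q.side) (p : ℝ) :
    volume Q.set ^ p = ENNReal.ofReal (Q.side ^ (n * p)) := by
  have hside (i : Fin n) : Q.center i + Q.side / 2 - (Q.center i - Q.side / 2) = Q.side := by ring
  simp only [set_eq_pi_Ico, Real.volume_pi_Ico, hside, Finset.prod_const, Finset.card_univ,
    Fintype.card_fin]
  rw [← ENNReal.ofReal_pow hs.le, ENNReal.ofReal_rpow_of_pos (by positivity),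
    ← Real.rpow_natCast, ← Real.rpow_mul hs.le]

lemma dilate_one (Q : Cube n) : Q.dilate 1 = Q := by
  simp [dilate]

lemma side_pos_of_mem [NeZero n] (Q : Cube n) {x : Fin n → ℝ} (hx : x ∈ Q.set) :
    0 < Q.side := by
  have := hx 0
  linarith [this.1, this.2]

lemma dilate_set_mono (Q : Cube n) (hs : 0 ≤ Q.side) {s t : ℝ} (hst : s ≤ t) :
    (Q.dilate s).set ⊆ (Q.dilate t).set := by
  intro x hx i
  have := hx i
  have hmul : s * Q.side ≤ t * Q.side := mul_le_mul_of_nonneg_right hst hs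
  simp only [dilate] at this ⊢
  constructor <;> linarith [this.1, this.2]

lemma norm_sub_le_side (Q : Cube n) (hs : 0 ≤ Q.side) {x z : Fin n → ℝ}
    (hx : x ∈ Q.set) (hz : z ∈ Q.set) : ‖x - z‖ ≤ Q.side := by
  refine (pi_norm_le_iff_of_nonneg hs).2 fun i => ?_
  rw [Pi.sub_apply, Real.norm_eq_abs, abs_le]
  constructor <;> linarith [(hx i).1, (hx i).2, (hz i).1, (hz i).2]

end Cube

section Annuli

variable {n : ℕ}

lemma Sring_subset_dilate (Q : Cube n) (j : ℕ) : Sring Q j ⊆ (Q.dilate ((2 : ℝ) ^ j)).set := by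
  unfold Sring
  split_ifs with h
  · simp [h, Cube.dilate_one]
  · exact sdiff_subset

lemma exists_mem_Sring (Q : Cube n) {k : ℕ} {x : Fin n → ℝ}
    (hx : x ∈ (Q.dilate ((2 : ℝ) ^ k)).set) : ∃ j ≤ k, x ∈ Sring Q j := by
  classical
  have hex : ∃ j : ℕ, x ∈ (Q.dilate ((2 : ℝ) ^ j)).set := ⟨k, hx⟩
  refine ⟨Nat.find hex, Nat.find_min' hex hx, ?_⟩
  have hmem := Nat.find_spec hex
  unfold Sring
  split_ifs with h
  · rwa [h, pow_zero, Cube.dilate_one] at hmem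
  · exact ⟨hmem, Nat.find_min hex (by omega)⟩

lemma mring_subset_iUnion_Sring {m : ℕ} (Q : Cube n) (hs : 0 ≤ Q.side) (k : ℕ) :
    mring m Q k ⊆
      ⋃ j ∈ (Fintype.piFinset fun _ : Fin m => Finset.range (k + 2)).filter
        (fun j => Finset.univ.sup j = k + 1), {y | ∀ i, y i ∈ Sring Q (j i)} := by
  rintro y ⟨hy, hy'⟩
  choose j hjk hj using fun i => exists_mem_Sring Q (hy i)
  have hle : Finset.univ.sup j ≤ k + 1 := Finset.sup_le fun i _ => hjk i
  have hlt : ¬ Finset.univ.sup j ≤ k := fun h => hy' fun i =>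
    Q.dilate_set_mono hs
      (pow_le_pow_right₀ one_le_two ((Finset.le_sup (Finset.mem_univ i)).trans h))
      (Sring_subset_dilate Q _ (hj i))
  simp only [mem_iUnion]
  refine ⟨j, ?_, hj⟩
  simp only [Finset.mem_filter, Fintype.mem_piFinset, Finset.mem_range]
  exact ⟨fun i => by have := hjk i; omega, by omega⟩

end Annuli

section KernelDifference

variable {n m : ℕ} {r : ℝ} (K : (Fin n → ℝ) → (Fin m → Fin n → ℝ) → ℝ) (x z : Fin n → ℝ)

lemma kdiffM_mono (hr : 1 ≤ r) {S T : Set (Fin m → Fin n → ℝ)} (h : S ⊆ T) :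
    kdiffM m r K x z S ≤ kdiffM m r K x z T := by
  unfold kdiffM
  split_ifs
  · exact essSup_mono_measure (Measure.restrict_mono h le_rfl).absolutelyContinuous
  · exact ENNReal.rpow_le_rpow (lintegral_mono_set h)
      (div_nonneg (by linarith) (by linarith))

lemma kdiffM_empty (hr : 1 ≤ r) : kdiffM m r K x z ∅ = 0 := by
  unfold kdiffM
  split_ifs with h
  · simp
  · have : 1 < r := lt_of_le_of_ne hr (Ne.symm h)
    simp [ENNReal.zero_rpow_of_pos (div_pos (sub_pos.2 this) (by linarith))]

lemma kdiffM_union_le (hr : 1 ≤ r) (S T : Set (Fin m → Fin n → ℝ)) :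
    kdiffM m r K x z (S ∪ T) ≤ kdiffM m r K x z S + kdiffM m r K x z T := by
  unfold kdiffM
  split_ifs
  · refine essSup_le_of_ae_le _ ?_
    rw [EventuallyLE, ae_restrict_union_iff]
    constructor
    · filter_upwards [ENNReal.ae_le_essSup _] with y hy using hy.trans le_self_add
    · filter_upwards [ENNReal.ae_le_essSup _] with y hy using hy.trans le_add_self
  · have hnonneg : 0 ≤ (r - 1) / r := div_nonneg (by linarith) (by linarith)
    exact (ENNReal.rpow_le_rpow (lintegral_union_le _ _ _) hnonneg).trans
      (ENNReal.rpow_add_le_add_rpow _ _ hnonneg ((div_le_one (by linarith)).2 (by linarith)))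

lemma kdiffM_biUnion_finset_le (hr : 1 ≤ r) {ι : Type*} (s : Finset ι)
    (S : ι → Set (Fin m → Fin n → ℝ)) :
    kdiffM m r K x z (⋃ j ∈ s, S j) ≤ ∑ j ∈ s, kdiffM m r K x z (S j) := by
  classical
  induction s using Finset.induction_on with
  | empty => simp [kdiffM_empty K x z hr]
  | insert a s ha ih =>
    rw [Finset.set_biUnion_insert, Finset.sum_insert ha]
    exact (kdiffM_union_le K x z hr _ _).trans (by gcongr)

lemma kdiffM_mring_le (hr : 1 ≤ r) (Q : Cube n) (hs : 0 ≤ Q.side) (k : ℕ) {B : ℝ≥0∞}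
    (hB : ∀ j : Fin m → ℕ, Finset.univ.sup j = k + 1 →
      kdiffM m r K x z {y | ∀ i, y i ∈ Sring Q (j i)} ≤ B) :
    kdiffM m r K x z (mring m Q k) ≤ ENNReal.ofReal (((k + 2 : ℕ) : ℝ) ^ m) * B := by
  refine (kdiffM_mono K x z hr (mring_subset_iUnion_Sring Q hs k)).trans
    ((kdiffM_biUnion_finset_le K x z hr _ _).trans ?_)
  refine (Finset.sum_le_card_nsmul _ _ B fun j hj => hB j (Finset.mem_filter.1 hj).2).trans ?_
  rw [nsmul_eq_mul, ← Nat.cast_pow, ENNReal.ofReal_natCast]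
  gcongr
  refine (Finset.card_filter_le _ _).trans ?_
  simp

end KernelDifference

lemma summable_pow_mul_two_rpow_neg (m : ℕ) {ε : ℝ} (hε : 0 < ε) :
    Summable fun k : ℕ => ((k + 2 : ℕ) : ℝ) ^ m * (2 : ℝ) ^ (-(ε * ((k + 1 : ℕ) : ℝ))) := by
  have hlt : ‖(2 : ℝ) ^ (-ε)‖ < 1 := by
    rw [Real.norm_of_nonneg (by positivity)]
    exact Real.rpow_lt_one_of_one_lt_of_neg one_lt_two (neg_lt_zero.2 hε)
  have hgeom := (summable_pow_mul_geometric_of_norm_lt_one m hlt).comp_injective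
    (add_left_injective 2)
  refine (hgeom.mul_right ((2 : ℝ) ^ ε)).congr fun k => ?_
  rw [Function.comp_apply, mul_assoc, ← Real.rpow_natCast ((2 : ℝ) ^ (-ε)), ← Real.rpow_mul two_pos.le,
    ← Real.rpow_add two_pos]
  congr 2
  push_cast
  ring

/-- **Proposition 3.2**: assumption (H2) implies the m-linear `L^r`-Hörmander
condition, quantitatively `K_r ≤ c·C` with `c` depending only on `n, m, δ, r`. -/
theorem H2_implies_Lr_Hormander (n m : ℕ) (hn : 1 ≤ n) (hm : 1 ≤ m)
    (r : ℝ) (hr : 1 ≤ r) (δ : ℝ) (hδ : n / r < δ) :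
    ∃ c : ℝ, 0 < c ∧
      ∀ (K : (Fin n → ℝ) → (Fin m → Fin n → ℝ) → ℝ) (C : ℝ), 0 ≤ C →
        -- assumption (H2)
        (∀ (Q : Cube n), 0 < Q.side →
          ∀ x ∈ (Q.dilate (1 / 2)).set, ∀ z ∈ (Q.dilate (1 / 2)).set,
          ∀ j : Fin m → ℕ, j ≠ 0 →
            kdiffM m r K x z {y | ∀ i, y i ∈ Sring Q (j i)} ≤
              ENNReal.ofReal (C * ‖x - z‖ ^ ((m : ℝ) * (δ - n / r))) *
                volume Q.set ^ (-((m : ℝ) * δ / n)) *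
                ENNReal.ofReal ((2 : ℝ) ^ (-((m : ℝ) * δ * ((Finset.univ.sup j : ℕ) : ℝ))))) →
        KhormM m r K ≤ ENNReal.ofReal (c * C) := by
  have hε : 0 < (m : ℝ) * (δ - n / r) :=
    mul_pos (by exact_mod_cast hm) (sub_pos.2 hδ)
  have hsum := summable_pow_mul_two_rpow_neg m hε
  set a : ℕ → ℝ := fun k =>
    ((k + 2 : ℕ) : ℝ) ^ m * (2 : ℝ) ^ (-((m : ℝ) * (δ - n / r) * ((k + 1 : ℕ) : ℝ))) with ha
  have ha_pos (k : ℕ) : 0 < a k := by positivity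
  refine ⟨∑' k, a k, hsum.tsum_pos (fun k => (ha_pos k).le) 0 (ha_pos 0), fun K C hC h => ?_⟩
  refine iSup_le fun Q => iSup_le fun x => iSup_le fun z => ?_
  obtain ⟨x, hx⟩ := x
  obtain ⟨z, hz⟩ := z
  have : NeZero n := ⟨by omega⟩
  have hhalf := (Q.dilate (1 / 2)).side_pos_of_mem hx
  have hs : 0 < Q.side := by simpa [Cube.dilate] using hhalf
  have hn0 : (n : ℝ) ≠ 0 := NeZero.ne _
  have hxz : ‖x - z‖ ≤ Q.side :=
    ((Q.dilate (1 / 2)).norm_sub_le_side hhalf.le hx hz).trans (by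
      simp only [Cube.dilate]; linarith)
  have hterm (k : ℕ) : volume ((Q.dilate ((2 : ℝ) ^ (k + 1))).set) ^ ((m : ℝ) / r) *
      kdiffM m r K x z (mring m Q k) ≤ ENNReal.ofReal (a k * C) := by
    have hB := kdiffM_mring_le K x z hr Q hs.le k
      (B := ENNReal.ofReal (C * Q.side ^ ((m : ℝ) * (δ - n / r)) *
        Q.side ^ (n * (-((m : ℝ) * δ / n))) *
        (2 : ℝ) ^ (-((m : ℝ) * δ * ((k + 1 : ℕ) : ℝ))))) fun j hj => by
        have hj0 : j ≠ 0 := by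
          rintro rfl
          have : Finset.univ.sup (0 : Fin m → ℕ) ≤ 0 := Finset.sup_le fun _ _ => le_rfl
          omega
        refine (h Q hs x hx z hz j hj0).trans ?_
        rw [Q.volume_set_rpow hs, hj, ← ENNReal.ofReal_mul (by positivity),
          ← ENNReal.ofReal_mul (by positivity)]
        gcongr
    refine (mul_le_mul_right hB _).trans ?_
    rw [Cube.volume_set_rpow _ (by simp only [Cube.dilate]; positivity),
      ← ENNReal.ofReal_mul (by positivity),
      ← ENNReal.ofReal_mul (by simp only [Cube.dilate]; positivity)]
    refine ENNReal.ofReal_le_ofReal (le_of_eq ?_)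
    have hQ : Q.side ^ (n * ((m : ℝ) / r)) * Q.side ^ ((m : ℝ) * (δ - n / r)) *
        Q.side ^ (n * (-((m : ℝ) * δ / n))) = 1 := by
      rw [← Real.rpow_add hs, ← Real.rpow_add hs]
      convert Real.rpow_zero _ using 2
      field_simp
      ring
    have h2 : ((2 : ℝ) ^ (k + 1)) ^ (n * ((m : ℝ) / r)) *
        (2 : ℝ) ^ (-((m : ℝ) * δ * ((k + 1 : ℕ) : ℝ))) =
        (2 : ℝ) ^ (-((m : ℝ) * (δ - n / r) * ((k + 1 : ℕ) : ℝ))) := by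
      rw [← Real.rpow_natCast, ← Real.rpow_mul two_pos.le, ← Real.rpow_add two_pos]
      congr 1
      ring
    simp only [Cube.dilate, ha]
    rw [Real.mul_rpow (by positivity) hs.le, ← h2]
    linear_combination (((2 : ℝ) ^ (k + 1)) ^ (n * ((m : ℝ) / r)) *
        (2 : ℝ) ^ (-((m : ℝ) * δ * ((k + 1 : ℕ) : ℝ))) * ((k + 2 : ℕ) : ℝ) ^ m * C) * hQ
  calc _ ≤ ∑' k, ENNReal.ofReal (a k * C) := ENNReal.tsum_le_tsum hterm
    _ = ENNReal.ofReal ((∑' k, a k) * C) := by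
      rw [← ENNReal.ofReal_tsum_of_nonneg (fun k => mul_nonneg (ha_pos k).le hC)
        (hsum.mul_right C), tsum_mul_right]

end
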